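/- Let V be a finite-dimensional vector space over a field of characteristic 0 and N: V → V a nilpotent endomorphism. Then there exists a unique finite increasing filtration W_• of V (the monodromy filtration centered at 0) such that N(W_i) ⊆ W_{i-2} for all i and, for every i ≥ 0, the induced map N^i: Gr^W_i V → Gr^W_{-i} V is an isomorphism. -/

import Mathlib

/-- The defining properties of the monodromy filtration. -/
def IsMon {k V : Type*} [Field k] [AddCommGroup V] [Module k V] (N : V →ₗ[k] V)
    (W : ℤ → Submodule k V) : Prop :=
      Monotone W ∧
      (∃ a : ℤ, ∀ i < a, W i = ⊥) ∧
      (∃ b : ℤ, ∀ i, b < i → W i = ⊤) ∧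
      (∀ i : ℤ, (W i).map N ≤ W (i - 2)) ∧
      (∀ i : ℕ,
        (W i ⊓ (W (-(i : ℤ) - 1)).comap (N ^ i) ≤ W ((i : ℤ) - 1)) ∧
        (W (-(i : ℤ)) ≤ (W (i : ℤ)).map (N ^ i) ⊔ W (-(i : ℤ) - 1)))

/-- The explicit formula for the monodromy filtration. -/
def monF {k V : Type*} [Field k] [AddCommGroup V] [Module k V] (N : V →ₗ[k] V)
    (l : ℤ) : Submodule k V :=
  ⨆ j : ℕ, (LinearMap.ker (N ^ (l + 2 * j + 1).toNat)).map (N ^ j)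

section
variable {k V : Type*} [Field k] [AddCommGroup V] [Module k V] {N : V →ₗ[k] V}

theorem pow_zero_of_le {a b : ℕ} (h : a ≤ b) {x : V} (hx : (N ^ a) x = 0) : (N ^ b) x = 0 := by
  obtain ⟨c, rfl⟩ := Nat.exists_eq_add_of_le h
  rw [add_comm, pow_add, Module.End.mul_apply, hx, map_zero]

theorem mem_monF {l : ℤ} (j n : ℕ) (hn : (n : ℤ) ≤ l + 2 * j + 1) {x : V}
    (hx : (N ^ n) x = 0) : (N ^ j) x ∈ monF N l := by
  refine Submodule.mem_iSup_of_mem j ⟨x, ?_, rfl⟩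
  exact pow_zero_of_le (by omega) hx

theorem monF_le {l : ℤ} {S : Submodule k V}
    (h : ∀ (j n : ℕ) (x : V), (n : ℤ) = l + 2 * j + 1 → (N ^ n) x = 0 → (N ^ j) x ≠ 0 →
      (N ^ j) x ∈ S) :
    monF N l ≤ S := by
  refine iSup_le fun j => ?_
  rintro _ ⟨x, hx, rfl⟩
  by_cases h0 : (N ^ j) x = 0
  · rw [h0]; exact S.zero_mem
  by_cases hp : 0 ≤ l + 2 * j + 1
  · exact h j _ x (Int.toNat_of_nonneg hp) hx h0
  · exfalso
    apply h0
    have : (l + 2 * j + 1).toNat = 0 := by omega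
    have hx' : (N ^ (l + 2 * j + 1).toNat) x = 0 := hx
    rw [this] at hx'
    exact pow_zero_of_le (Nat.zero_le _) hx'

theorem monF_neg_le (i : ℕ) : monF N (-(i : ℤ)) ≤ (monF N i).map (N ^ i) := by
  apply monF_le
  intro j n x hn hx h0
  have hj : i ≤ j := by
    by_contra hlt
    exact h0 (pow_zero_of_le (by omega) hx)
  obtain ⟨c, rfl⟩ := Nat.exists_eq_add_of_le hj
  rw [pow_add, Module.End.mul_apply]
  exact ⟨_, mem_monF c n (by push_cast at hn; omega) hx, rfl⟩

theorem isMon_monF (hN : IsNilpotent N) : IsMon N (monF N) := by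
  obtain ⟨d, hd⟩ := hN
  have hmap : ∀ i : ℤ, (monF N i).map N ≤ monF N (i - 2) := by
    intro i
    rw [Submodule.map_le_iff_le_comap]
    apply monF_le
    intro j n x hn hx _
    rw [Submodule.mem_comap, ← Module.End.mul_apply, ← pow_succ']
    exact mem_monF _ n (by push_cast; omega) hx
  refine ⟨?_, ⟨-d, ?_⟩, ⟨d, ?_⟩, hmap, ?_⟩
  · intro a b hab
    apply monF_le
    intro j n x hn hx _
    exact mem_monF j n (by omega) hx
  · intro i hi
    rw [eq_bot_iff]
    apply monF_le
    intro j n x hn hx h0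
    exfalso
    apply h0
    rcases le_total d j with h | h
    · exact pow_zero_of_le h (by rw [hd]; rfl)
    · exact pow_zero_of_le (by omega) hx
  · intro i hi
    rw [eq_top_iff]
    intro x _
    exact mem_monF (l := i) 0 d (by push_cast; omega) (by rw [hd]; rfl)
  · intro i
    refine ⟨?_, (monF_neg_le i).trans le_sup_left⟩
    rintro x ⟨-, hx⟩
    have hx' : (N ^ i) x ∈ monF N (-((i + 1 : ℕ) : ℤ)) := by
      have e : (-((i + 1 : ℕ) : ℤ)) = -(i : ℤ) - 1 := by push_cast; ring
      rw [e]; exact hx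
    obtain ⟨y, hy, hxy⟩ := monF_neg_le _ hx'
    have h1 : N y ∈ monF N ((i : ℤ) - 1) := by
      have := hmap _ (Submodule.mem_map_of_mem hy)
      have e : ((i + 1 : ℕ) : ℤ) - 2 = (i : ℤ) - 1 := by push_cast; ring
      rwa [e] at this
    have h2 : x - N y ∈ monF N ((i : ℤ) - 1) := by
      refine mem_monF (l := (i : ℤ) - 1) 0 i (x := x - N y) (by push_cast; omega) ?_
      rw [map_sub, ← hxy, pow_succ, Module.End.mul_apply, sub_self]
    simpa using add_mem h2 h1

theorem IsMon.map_pow {W : ℤ → Submodule k V} (h : IsMon N W) (j : ℕ) :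
    ∀ (i : ℤ) (x : V), x ∈ W i → (N ^ j) x ∈ W (i - 2 * j) := by
  induction j with
  | zero => intro i x hx; simpa using hx
  | succ j ih =>
    intro i x hx
    have := h.2.2.2.1 _ (Submodule.mem_map_of_mem (ih i x hx))
    rw [pow_succ', Module.End.mul_apply]
    convert this using 2
    push_cast; ring

theorem IsMon.ker_le {W : ℤ → Submodule k V} (h : IsMon N W) (i : ℕ) {x : V}
    (hx : (N ^ i) x = 0) : x ∈ W ((i : ℤ) - 1) := by
  obtain ⟨b, hb⟩ := h.2.2.1
  have key : ∀ m : ℕ, x ∈ W ((i : ℤ) + m - 1) → x ∈ W ((i : ℤ) - 1) := by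
    intro m
    induction m with
    | zero => intro hm; simpa using hm
    | succ m ih =>
      intro hm
      apply ih
      have := (h.2.2.2.2 (i + m)).1
      push_cast at this hm
      refine this ⟨?_, ?_⟩
      · have e : (i : ℤ) + (m + 1) - 1 = i + m := by ring
        rwa [e] at hm
      · change (N ^ (i + m)) x ∈ W (-((i : ℤ) + m) - 1)
        rw [pow_zero_of_le (Nat.le_add_right i m) hx]
        exact zero_mem _
  apply key (b.toNat + 2)
  rw [hb _ (by push_cast; omega)]
  trivial

theorem IsMon.neg_le {W : ℤ → Submodule k V} (h : IsMon N W) (i : ℕ) :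
    W (-(i : ℤ)) ≤ (W i).map (N ^ i) := by
  obtain ⟨a, ha⟩ := h.2.1
  have key : ∀ m i : ℕ, W (-((i + m : ℕ) : ℤ)) = ⊥ → W (-(i : ℤ)) ≤ (W i).map (N ^ i) := by
    intro m
    induction m with
    | zero => intro i hi; rw [add_zero] at hi; rw [hi]; exact bot_le
    | succ m ih =>
      intro i hi
      refine (h.2.2.2.2 i).2.trans (sup_le le_rfl ?_)
      have e : -(i : ℤ) - 1 = -((i + 1 : ℕ) : ℤ) := by push_cast; ring
      rw [e]
      refine (ih (i + 1) (by rw [← hi]; congr 2; push_cast; ring)).trans ?_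
      rintro _ ⟨y, hy, rfl⟩
      refine ⟨N y, ?_, by rw [pow_succ, Module.End.mul_apply]⟩
      exact h.1 (by push_cast; omega) (h.2.2.2.1 _ (Submodule.mem_map_of_mem hy))
  exact key (a.natAbs + 1) i (ha _ (by omega))

theorem IsMon.le {W W' : ℤ → Submodule k V} (h : IsMon N W) (h' : IsMon N W') : W ≤ W' := by
  obtain ⟨b, hb⟩ := h'.2.2.1
  have key : ∀ m l : ℕ, b < (l : ℤ) + m → W l ≤ W' l := by
    intro m
    induction m with
    | zero => intro l hl; rw [hb l (by simpa using hl)]; exact le_top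
    | succ m ih =>
      intro l hl x hx
      have h1 : (N ^ (l + 1)) x ∈ W (-((l + 2 : ℕ) : ℤ)) := by
        have := h.map_pow (l + 1) _ _ hx
        convert this using 2
        push_cast; ring
      obtain ⟨y, hy, hxy⟩ := h.neg_le _ h1
      have hy' := ih (l + 2) (by push_cast at hl ⊢; omega) hy
      have h2 : N y ∈ W' l := by
        have := h'.2.2.2.1 _ (Submodule.mem_map_of_mem hy')
        convert this using 2
        push_cast; ring
      have h3 : x - N y ∈ W' l := by
        have := h'.ker_le (l + 1) (x := x - N y) (by
          rw [map_sub, ← hxy, pow_succ _ (l + 1), Module.End.mul_apply, sub_self])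
        convert this using 2
        push_cast; ring
      simpa using add_mem h3 h2
  have nn : ∀ l : ℕ, W l ≤ W' l := fun l => key (b.toNat + 1) l (by push_cast; omega)
  intro l
  obtain ⟨i, rfl | rfl⟩ := l.eq_nat_or_neg
  · exact nn i
  · refine (h.neg_le i).trans ?_
    rintro _ ⟨y, hy, rfl⟩
    have := h'.map_pow i _ _ (nn i hy)
    convert this using 2
    ring

end


/-- existence and uniqueness of the monodromy filtration of a nilpotent
endomorphism `N` of a finite-dimensional vector space `V` over a field of characteristic 0:
a unique finite increasing filtration `W` with `N(W i) ⊆ W (i - 2)` such that for all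
`i ≥ 0` the induced map `N^i : Gr^W_i V → Gr^W_{-i} V` is an isomorphism (expressed
as injectivity and surjectivity conditions on submodules). -/
theorem stmt7 {k V : Type*} [Field k] [CharZero k] [AddCommGroup V] [Module k V]
    [FiniteDimensional k V] (N : V →ₗ[k] V) (hN : IsNilpotent N) :
    ∃! W : ℤ → Submodule k V,
      Monotone W ∧
      (∃ a : ℤ, ∀ i < a, W i = ⊥) ∧
      (∃ b : ℤ, ∀ i, b < i → W i = ⊤) ∧
      (∀ i : ℤ, (W i).map N ≤ W (i - 2)) ∧
      (∀ i : ℕ,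
        (W i ⊓ (W (-(i : ℤ) - 1)).comap (N ^ i) ≤ W ((i : ℤ) - 1)) ∧
        (W (-(i : ℤ)) ≤ (W (i : ℤ)).map (N ^ i) ⊔ W (-(i : ℤ) - 1))) := by


  exact ⟨monF N, isMon_monF hN, fun W hW =>
    le_antisymm (IsMon.le hW (isMon_monF hN)) (IsMon.le (isMon_monF hN) hW)⟩
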